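/- Fix an integer k ≥ 2 and x⁰ ∈ [0,1)^d, and set xⁿ := {kⁿ x⁰} (coordinatewise fractional part). Let q be a minimal idempotent ultrafilter on ℕ₀ such that the sequence xⁿ converges to x⁰ along q. Then V_q := alglim_{n→q}(xⁿ) is an affine subspace of ℝ^d defined over ℚ: there exist a point z ∈ ℚ^d and a linear subspace W ⊆ ℝ^d spanned by vectors with rational coordinates such that V_q = z + W. -/

import Mathlib

/-- An algebraic variety in `ℝ^ι`: the common zero set of a family of polynomials. -/
def IsAlgVariety {ι : Type} (V : Set (ι → ℝ)) : Prop :=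
  ∃ F : Set (MvPolynomial ι ℝ), V = {x | ∀ f ∈ F, MvPolynomial.eval x f = 0}

/-- The Zariski closure of a set `X ⊆ ℝ^ι`: the smallest algebraic variety containing
it, i.e. the zero locus of the ideal of `X`. -/
def zariskiClosure {ι : Type} (X : Set (ι → ℝ)) : Set (ι → ℝ) :=
  {x | ∀ f : MvPolynomial ι ℝ,
    (∀ y ∈ X, MvPolynomial.eval y f = 0) → MvPolynomial.eval x f = 0}

/-- A variety is irreducible if it is not the union of two algebraic varieties
other than itself. -/
def IsIrreducibleVariety {ι : Type} (V : Set (ι → ℝ)) : Prop :=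
  ∀ V₁ V₂ : Set (ι → ℝ), IsAlgVariety V₁ → IsAlgVariety V₂ → V = V₁ ∪ V₂ →
    V = V₁ ∨ V = V₂
/-- The sum of two ultrafilters on `ℕ`: `E ∈ usum p q ↔ {n | {m | n + m ∈ E} ∈ q} ∈ p`. -/
def usum (p q : Ultrafilter ℕ) : Ultrafilter ℕ :=
  p.bind fun n => q.map fun m => n + m

/-- `algLim` of a sequence along an ultrafilter: the intersection over `I ∈ p` of the
Zariski closures of `{x n : n ∈ I}`. -/
def algLim {ι : Type} (x : ℕ → (ι → ℝ)) (p : Ultrafilter ℕ) : Set (ι → ℝ) :=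
  ⋂ I ∈ p, zariskiClosure (x '' I)

theorem eventually_usum {p q : Ultrafilter ℕ} {P : ℕ → Prop} :
    (∀ᶠ m in (usum p q : Filter ℕ), P m) ↔
      ∀ᶠ n in (p : Filter ℕ), ∀ᶠ m in (q : Filter ℕ), P (n + m) :=
  Iff.rfl

theorem mem_algLim {ι : Type} {x : ℕ → ι → ℝ} {q : Ultrafilter ℕ} {y : ι → ℝ} :
    y ∈ algLim x q ↔ ∀ f : MvPolynomial ι ℝ,
      (∀ᶠ m in (q : Filter ℕ), MvPolynomial.eval (x m) f = 0) → MvPolynomial.eval y f = 0 := by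
  simp only [algLim, Set.mem_iInter, zariskiClosure, Set.mem_ofPred_eq]
  constructor
  · intro h f hf
    refine h _ hf f ?_
    rintro _ ⟨m, hm, rfl⟩
    exact hm
  · intro h I hI f hf
    exact h f (Filter.mem_of_superset hI fun m hm => hf _ ⟨m, hm, rfl⟩)

/-- A minimal idempotent ultrafilter on `ℕ` is nonprincipal. -/
theorem le_atTop_of_minimal_idempotent {q : Ultrafilter ℕ} (hqidem : usum q q = q)
    (hqmin : ∀ r : Ultrafilter ℕ, ∃ s : Ultrafilter ℕ, usum s (usum r q) = q) :
    (q : Filter ℕ) ≤ Filter.atTop := by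
  rw [← Nat.cofinite_eq_atTop]
  rcases q.le_cofinite_or_eq_pure with h | ⟨a, rfl⟩
  · exact h
  · exfalso
    have h1 : ∀ᶠ m in ((pure a : Ultrafilter ℕ) : Filter ℕ), m = a := by simp
    have ha : a = 0 := by
      have h2 := h1
      rw [← hqidem, eventually_usum] at h2
      simpa using h2
    obtain ⟨s, hs⟩ := hqmin (pure 1)
    rw [← hs, eventually_usum] at h1
    obtain ⟨n, hn⟩ := h1.exists
    rw [eventually_usum] at hn
    simp [ha] at hn

/-- The ideal of polynomials vanishing along `x` eventually with respect to a filter. -/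
def eventualIdeal {ι : Type} (x : ℕ → ι → ℝ) (l : Filter ℕ) : Ideal (MvPolynomial ι ℝ) where
  carrier := {f | ∀ᶠ m in l, MvPolynomial.eval (x m) f = 0}
  add_mem' := by
    intro f g hf hg
    filter_upwards [hf, hg] with m h1 h2
    rw [map_add, h1, h2, add_zero]
  zero_mem' := by simp
  smul_mem' := by
    intro c f hf
    filter_upwards [hf] with m h
    simp [h]

theorem mem_eventualIdeal {ι : Type} {x : ℕ → ι → ℝ} {l : Filter ℕ} {f : MvPolynomial ι ℝ} :
    f ∈ eventualIdeal x l ↔ ∀ᶠ m in l, MvPolynomial.eval (x m) f = 0 :=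
  Iff.rfl

/-- Along an idempotent ultrafilter, most shifts of a sequence eventually satisfy all the
polynomial equations that the sequence itself eventually satisfies. -/
theorem eventually_eventualIdeal_le_shift {ι : Type} [Finite ι] (x : ℕ → ι → ℝ)
    {q : Ultrafilter ℕ} (hqidem : usum q q = q) :
    ∀ᶠ n in (q : Filter ℕ), eventualIdeal x q ≤ eventualIdeal (fun m => x (n + m)) q := by
  obtain ⟨S, hS⟩ := IsNoetherian.noetherian (eventualIdeal x q)
  rw [← hS]
  simp only [Submodule.span_le, Set.subset_def, SetLike.mem_coe]
  refine (Filter.eventually_all_finset S).2 fun f hf => ?_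
  have h : f ∈ eventualIdeal x q := hS ▸ Submodule.subset_span hf
  rw [mem_eventualIdeal, ← hqidem, eventually_usum] at h
  exact h

/-- If a polynomial vanishes at `z + a ^ j • w` for all `j`, where `1 < a`, then it vanishes on
the whole line `z + t • w`. -/
theorem MvPolynomial.eval_line_eq_zero {ι : Type} (f : MvPolynomial ι ℝ) (z w : ι → ℝ) {a : ℝ}
    (ha : 1 < a) (h : ∀ j : ℕ, MvPolynomial.eval (z + a ^ j • w) f = 0) (t : ℝ) :
    MvPolynomial.eval (z + t • w) f = 0 := by
  have key : ∀ s : ℝ, Polynomial.eval s (MvPolynomial.aeval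
      (fun i => Polynomial.C (z i) + Polynomial.X * Polynomial.C (w i)) f)
      = MvPolynomial.eval (z + s • w) f := by
    intro s
    clear h
    induction f using MvPolynomial.induction_on with
    | C r => simp
    | add f g hf hg => simp_all
    | mul_X f i hf => simp_all [mul_comm s]
  have h0 := Polynomial.eq_zero_of_infinite_isRoot _ (Set.Infinite.mono
    (s := Set.range fun j : ℕ => a ^ j)
    (by rintro _ ⟨j, rfl⟩; exact (key _).trans (h j))
    (Set.infinite_range_of_injective (pow_right_injective₀ (by linarith) ha.ne')))
  rw [← key, h0, Polynomial.eval_zero]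

/-- If `x (n + m) = a • x m - c` for most `m`, then the algebraic limit of `x` is mapped to
itself by `y ↦ a • y - c`, provided that the shift by `n` preserves the eventual ideal. -/
theorem smul_sub_mem_algLim {ι : Type} {x : ℕ → ι → ℝ} {q : Ultrafilter ℕ} {n : ℕ} {a : ℝ}
    {c : ι → ℝ} (hn : eventualIdeal x q ≤ eventualIdeal (fun m => x (n + m)) q)
    (hx : ∀ᶠ m in (q : Filter ℕ), x (n + m) = a • x m - c) {y : ι → ℝ} (hy : y ∈ algLim x q) :
    a • y - c ∈ algLim x q := by
  rw [mem_algLim] at hy ⊢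
  intro f hf
  have key : ∀ u : ι → ℝ, MvPolynomial.eval u (MvPolynomial.bind₁
      (fun i => MvPolynomial.C a * MvPolynomial.X i - MvPolynomial.C (c i)) f)
      = MvPolynomial.eval (a • u - c) f := by
    intro u
    clear hf
    induction f using MvPolynomial.induction_on with
    | C r => simp
    | add f g hf hg => simp_all
    | mul_X f i hf => simp_all
  rw [← key]
  apply hy
  filter_upwards [hx, mem_eventualIdeal.1 (hn hf)] with m h1 h2
  rw [key, ← h1, h2]

/-- If `V = algLim x q` is invariant under an expanding homothety centred at `z`, then it is a
cone with apex `z`. -/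
theorem cone_of_expanding_invariant {ι : Type} {x : ℕ → ι → ℝ} {q : Ultrafilter ℕ} {a : ℝ}
    (ha : 1 < a) {z : ι → ℝ}
    (h : ∀ y ∈ algLim x q, z + a • (y - z) ∈ algLim x q) {y : ι → ℝ} (hy : y ∈ algLim x q)
    (t : ℝ) : z + t • (y - z) ∈ algLim x q := by
  have hj : ∀ j : ℕ, z + a ^ j • (y - z) ∈ algLim x q := by
    intro j
    induction j with
    | zero => simpa using hy
    | succ j ih =>
      have := h _ ih
      rwa [add_sub_cancel_left, smul_smul, ← pow_succ'] at this
  rw [mem_algLim]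
  intro f hf
  exact f.eval_line_eq_zero z _ ha (fun j => mem_algLim.1 (hj j) f hf) t

/-- A set which is a cone with respect to both `z` and `z'` is invariant under translation by
multiples of `z' - z`. -/
theorem add_smul_mem_of_cones {E : Type*} [AddCommGroup E] [Module ℝ E] {V : Set E} {z z' : E}
    (hz : ∀ y ∈ V, ∀ t : ℝ, z + t • (y - z) ∈ V)
    (hz' : ∀ y ∈ V, ∀ t : ℝ, z' + t • (y - z') ∈ V) {y : E} (hy : y ∈ V) (c : ℝ) :
    y + c • (z' - z) ∈ V := by
  have h : ∀ y ∈ V, ∀ c : ℝ, c ≠ 1 → y + c • (z' - z) ∈ V := by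
    intro y hy c hc
    have hc' : 1 - c ≠ 0 := sub_ne_zero.2 hc.symm
    convert hz' _ (hz y hy (1 - c)⁻¹) (1 - c) using 1
    have e : (1 - c) • ((1 - c)⁻¹ • (y - z)) = y - z := smul_inv_smul₀ hc' _
    rw [add_sub_right_comm, smul_add, e]
    module
  rcases eq_or_ne c 1 with rfl | hc
  · convert h _ (h y hy (1 / 2) (by norm_num)) (1 / 2) (by norm_num) using 1
    module
  · exact h y hy c hc

/-- Affine subspaces contain the algebraic limits of sequences which eventually lie in them. -/
theorem sub_mem_of_mem_algLim {ι : Type} [Finite ι] {x : ℕ → ι → ℝ} {q : Ultrafilter ℕ}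
    {z : ι → ℝ} {W : Submodule ℝ (ι → ℝ)} (h : ∀ᶠ m in (q : Filter ℕ), x m - z ∈ W)
    {y : ι → ℝ} (hy : y ∈ algLim x q) : y - z ∈ W := by
  classical
  have := Fintype.ofFinite ι
  by_contra hyW
  obtain ⟨g, hg, hgW⟩ := Submodule.exists_le_ker_of_notMem hyW
  have key : ∀ u : ι → ℝ, MvPolynomial.eval u (∑ i, MvPolynomial.C (g (Pi.single i 1)) *
      (MvPolynomial.X i - MvPolynomial.C (z i))) = g (u - z) := by
    intro u
    rw [g.pi_apply_eq_sum_univ (u - z)]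
    simp only [map_sum, map_mul, map_sub, MvPolynomial.eval_C, MvPolynomial.eval_X,
      Pi.sub_apply, smul_eq_mul]
    refine Finset.sum_congr rfl fun i _ => ?_
    rw [mul_comm]
    congr 2
    ext j
    simp [Pi.single_apply, eq_comm]
  apply hg
  rw [← key]
  refine mem_algLim.1 hy _ ?_
  filter_upwards [h] with m hm
  rw [key]
  exact hgW hm

theorem fract_pow_add_mul (k n m : ℕ) (x : ℝ) :
    Int.fract ((k : ℝ) ^ (n + m) * x) = Int.fract ((k : ℝ) ^ n * Int.fract ((k : ℝ) ^ m * x)) := by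
  rw [Int.fract_eq_fract]
  refine ⟨(k : ℤ) ^ n * ⌊(k : ℝ) ^ m * x⌋, ?_⟩
  have := Int.self_sub_floor ((k : ℝ) ^ m * x)
  rw [← this]
  push_cast
  ring

/-- If `{kᵐ x} → x` along a nonprincipal ultrafilter `q`, then the integer parts of
`kⁿ {kᵐ x}` are constant for `q`-most `m`. -/
theorem eventually_fract_pow_add {k : ℕ} {x : ℝ} {q : Ultrafilter ℕ}
    (hq : (q : Filter ℕ) ≤ Filter.atTop)
    (hx : Filter.Tendsto (fun m : ℕ => Int.fract ((k : ℝ) ^ m * x)) q (nhds x)) (n : ℕ) :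
    ∀ᶠ m in (q : Filter ℕ), Int.fract ((k : ℝ) ^ (n + m) * x) =
      (k : ℝ) ^ n * Int.fract ((k : ℝ) ^ m * x) - ⌊(k : ℝ) ^ n * x⌋ := by
  by_cases hint : Int.fract ((k : ℝ) ^ n * x) = 0
  · have h0 : ∀ m, n ≤ m → Int.fract ((k : ℝ) ^ m * x) = 0 := by
      intro m hm
      obtain ⟨l, rfl⟩ := Nat.exists_eq_add_of_le' hm
      rw [fract_pow_add_mul, hint]
      simp
    have hx0 : x = 0 := by
      refine tendsto_nhds_unique hx (tendsto_const_nhds.congr' ?_)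
      filter_upwards [hq (Filter.eventually_ge_atTop n)] with m hm
      exact (h0 m hm).symm
    simp [hx0]
  · have hlim := hx.const_mul ((k : ℝ) ^ n)
    have hlt : (⌊(k : ℝ) ^ n * x⌋ : ℝ) < (k : ℝ) ^ n * x := by
      have := (Int.fract_nonneg ((k : ℝ) ^ n * x)).lt_of_ne' hint
      rw [Int.fract] at this
      linarith
    filter_upwards [hlim.eventually_const_lt hlt,
      hlim.eventually_lt_const (Int.lt_floor_add_one _)] with m h1 h2
    rw [fract_pow_add_mul, Int.fract]
    congr 2
    exact Int.floor_eq_iff.2 ⟨h1.le, h2⟩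

/-- Let `k ≥ 2`, `x⁰ ∈ [0,1)^d`, `xⁿ = {kⁿ x⁰}`, and let `q` be a
minimal idempotent ultrafilter with `xⁿ → x⁰` along `q`. Then
`V_q = alglim_{n→q}(xⁿ)` is an affine subspace defined over `ℚ`: `V_q = z + W` for a
rational point `z` and a linear subspace `W` spanned by rational vectors. -/
theorem Vq_affine_rational (d k : ℕ) (hk : 2 ≤ k) (x0 : Fin d → ℝ)
    (hx0 : ∀ i, x0 i ∈ Set.Ico (0 : ℝ) 1)
    (q : Ultrafilter ℕ) (hqidem : usum q q = q)
    (hqmin : ∀ r : Ultrafilter ℕ, ∃ s : Ultrafilter ℕ, usum s (usum r q) = q)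
    (hrec : Filter.Tendsto
      (fun n => fun i => Int.fract ((k : ℝ) ^ n * x0 i)) ↑q (nhds x0)) :
    ∃ (z : Fin d → ℝ) (B : Set (Fin d → ℝ)),
      (∀ i, ∃ a : ℚ, z i = (a : ℝ)) ∧
      (∀ b ∈ B, ∀ i, ∃ a : ℚ, b i = (a : ℝ)) ∧
      algLim (fun n => fun i => Int.fract ((k : ℝ) ^ n * x0 i)) q
        = {y | ∃ w ∈ Submodule.span ℝ B, y = z + w} := by
  set x : ℕ → Fin d → ℝ := fun n i => Int.fract ((k : ℝ) ^ n * x0 i) with hx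
  set c : ℕ → Fin d → ℝ := fun n i => (⌊(k : ℝ) ^ n * x0 i⌋ : ℝ) with hc
  set Z : ℕ → Fin d → ℝ := fun n => ((k : ℝ) ^ n - 1)⁻¹ • c n with hZ
  have hk1 : (2 : ℝ) ≤ k := by exact_mod_cast hk
  have hq := le_atTop_of_minimal_idempotent hqidem hqmin
  have hkn : ∀ n, 1 ≤ n → (2 : ℝ) ≤ (k : ℝ) ^ n := fun n hn =>
    hk1.trans (le_self_pow₀ (by linarith) (by omega))
  have hcZ : ∀ n, 1 ≤ n → c n = ((k : ℝ) ^ n - 1) • Z n := fun n hn =>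
    (smul_inv_smul₀ (by linarith [hkn n hn]) _).symm
  have hxn : ∀ n, x n = (k : ℝ) ^ n • x0 - c n := fun n => funext fun _ => rfl
  have hxc : ∀ n, ∀ᶠ m in (q : Filter ℕ), x (n + m) = (k : ℝ) ^ n • x m - c n := by
    intro n
    filter_upwards [Filter.eventually_all.2 fun i =>
      eventually_fract_pow_add hq (tendsto_pi_nhds.1 hrec i) n] with m hm
    exact funext hm
  have hgood : ∀ᶠ n in (q : Filter ℕ), 1 ≤ n ∧
      ∀ y ∈ algLim x q, ∀ t : ℝ, Z n + t • (y - Z n) ∈ algLim x q := by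
    filter_upwards [hq (Filter.eventually_ge_atTop 1),
      eventually_eventualIdeal_le_shift x hqidem] with n hn1 hn2
    refine ⟨hn1, fun y hy t => cone_of_expanding_invariant
      (a := (k : ℝ) ^ n) (by linarith [hkn n hn1]) (fun y hy => ?_) hy t⟩
    convert smul_sub_mem_algLim hn2 (hxc n) hy using 1
    rw [hcZ n hn1]
    module
  have hZlim : Filter.Tendsto Z q (nhds x0) := by
    rw [tendsto_iff_norm_sub_tendsto_zero] at hrec ⊢
    refine squeeze_zero' (.of_forall fun _ => norm_nonneg _) ?_ hrec
    filter_upwards [hgood] with n hn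
    have h2 := hkn n hn.1
    have e : x n - x0 = ((k : ℝ) ^ n - 1) • (x0 - Z n) := by
      rw [hxn, hcZ n hn.1]
      module
    change ‖Z n - x0‖ ≤ ‖x n - x0‖
    rw [e, norm_smul, Real.norm_of_nonneg (by linarith), norm_sub_rev]
    exact le_mul_of_one_le_left (norm_nonneg _) (by linarith)
  have hx0V : x0 ∈ algLim x q := by
    rw [mem_algLim]
    intro f hf
    refine tendsto_nhds_unique ((f.continuous_eval.tendsto x0).comp hrec)
      (tendsto_const_nhds.congr' ?_)
    filter_upwards [hf] with m hm
    exact hm.symm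
  obtain ⟨N, hN1, hNcone⟩ := hgood.exists
  set G : Set ℕ := {n | 1 ≤ n ∧
      ∀ y ∈ algLim x q, ∀ t : ℝ, Z n + t • (y - Z n) ∈ algLim x q}
  have hZrat : ∀ n i, ∃ a : ℚ, Z n i = (a : ℝ) := fun n i =>
    ⟨((k : ℚ) ^ n - 1)⁻¹ * ⌊(k : ℝ) ^ n * x0 i⌋, by simp [hZ, hc]⟩
  set B : Set (Fin d → ℝ) := (fun n => Z n - Z N) '' G
  have hZB : ∀ n ∈ G, Z n - Z N ∈ Submodule.span ℝ B := fun n hn =>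
    Submodule.subset_span ⟨n, hn, rfl⟩
  refine ⟨Z N, B, hZrat N, ?_, ?_⟩
  · rintro _ ⟨n, -, rfl⟩ i
    obtain ⟨a, ha⟩ := hZrat n i
    obtain ⟨b, hb⟩ := hZrat N i
    exact ⟨a - b, by simp [ha, hb]⟩
  have hx0B : x0 - Z N ∈ Submodule.span ℝ B :=
    (Submodule.closed_of_finiteDimensional (Submodule.span ℝ B)).mem_of_tendsto
      (hZlim.sub_const (Z N)) (hgood.mono hZB)
  ext y
  constructor
  · intro hy
    refine ⟨y - Z N, sub_mem_of_mem_algLim ?_ hy, by abel⟩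
    filter_upwards [hgood] with n hn
    have e : x n - Z N = (k : ℝ) ^ n • (x0 - Z N) - ((k : ℝ) ^ n - 1) • (Z n - Z N) := by
      rw [hxn, hcZ n hn.1]
      module
    rw [e]
    exact sub_mem (Submodule.smul_mem _ _ hx0B) (Submodule.smul_mem _ _ (hZB n hn))
  · rintro ⟨w, hw, rfl⟩
    have hZN : Z N ∈ algLim x q := by simpa using hNcone x0 hx0V 0
    have htrans : ∀ y ∈ algLim x q, ∀ t : ℝ, y + t • w ∈ algLim x q := by
      induction hw using Submodule.span_induction with
      | mem w hw =>
        obtain ⟨n, hn, rfl⟩ := hw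
        exact fun y hy t => add_smul_mem_of_cones hNcone hn.2 hy t
      | zero => simp
      | add u v _ _ hu hv =>
        intro y hy t
        rw [smul_add, ← add_assoc]
        exact hv _ (hu y hy t) t
      | smul a u _ hu =>
        intro y hy t
        rw [smul_smul]
        exact hu y hy _
    simpa using htrans _ hZN 1
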